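/- Let n ≥ 1, let μ be a continuous translation-invariant valuation on ℝⁿ homogeneous of degree k (0 ≤ k ≤ n), and let E ⊆ ℝⁿ be a k-dimensional linear subspace. Then there exists a constant c ∈ ℝ (the Klain function of μ at E) such that μ(K) = c · ℋ^k(K) for every nonempty compact convex K ⊆ E, where ℋ^k is the k-dimensional Hausdorff measure. -/

import Mathlib

open MeasureTheory Pointwise
open scoped NNReal ENNReal

noncomputable section

/-- Euclidean `n`-space `ℝⁿ`. -/
abbrev Eucl (n : ℕ) : Type := EuclideanSpace ℝ (Fin n)

section Generic

variable {V : Type*} [NormedAddCommGroup V] [NormedSpace ℝ V]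

/-- `μ` is a valuation: whenever the union of two convex bodies `K`, `L` is again a convex
body `M` (with intersection the convex body `I`), one has `μ M + μ I = μ K + μ L`. -/
def IsValuation (μ : ConvexBody V → ℝ) : Prop :=
  ∀ K L M I : ConvexBody V,
    (M : Set V) = (K : Set V) ∪ (L : Set V) → (I : Set V) = (K : Set V) ∩ (L : Set V) →
      μ M + μ I = μ K + μ L

/-- The translate `K + x` of a convex body. -/
def ConvexBody.translate (K : ConvexBody V) (x : V) : ConvexBody V :=
  ⟨(K : Set V) + {x}, K.convex.add (convex_singleton x),
    K.isCompact.add isCompact_singleton, K.nonempty.add (Set.singleton_nonempty x)⟩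

/-- Translation invariance of a valuation. -/
def TransInv (μ : ConvexBody V → ℝ) : Prop :=
  ∀ (K : ConvexBody V) (x : V), μ (K.translate x) = μ K

/-- The dilate `t • K` of a convex body. -/
def ConvexBody.dilate (t : ℝ) (K : ConvexBody V) : ConvexBody V :=
  ⟨t • (K : Set V), K.convex.smul t, K.isCompact.smul t, K.nonempty.smul_set⟩

/-- Homogeneity of degree `k` of a valuation: `μ (t • K) = t ^ k * μ K` for `t > 0`. -/
def Homog (k : ℕ) (μ : ConvexBody V → ℝ) : Prop :=
  ∀ (K : ConvexBody V) (t : ℝ), 0 < t → μ (ConvexBody.dilate t K) = t ^ k * μ K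

/-- The reflection `-K` of a convex body. -/
def ConvexBody.reflect (K : ConvexBody V) : ConvexBody V :=
  ⟨-(K : Set V), K.convex.neg, K.isCompact.neg, K.nonempty.neg⟩

/-- Even valuations: `μ (-K) = μ K`. -/
def EvenVal (μ : ConvexBody V → ℝ) : Prop := ∀ K : ConvexBody V, μ K.reflect = μ K

/-- Odd valuations: `μ (-K) = -μ K`. -/
def OddVal (μ : ConvexBody V → ℝ) : Prop := ∀ K : ConvexBody V, μ K.reflect = -μ K

end Generic

/-- A convex and compact, possibly empty, set. -/
def IsConvexCompact {V : Type*} [NormedAddCommGroup V] [NormedSpace ℝ V] (S : Set V) : Prop :=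
  Convex ℝ S ∧ IsCompact S

namespace IsConvexCompact

variable {V : Type*} [NormedAddCommGroup V] [NormedSpace ℝ V] {S : Set V}

lemma inter_closed (hS : IsConvexCompact S) {T : Set V} (hT : Convex ℝ T) (hT' : IsClosed T) :
    IsConvexCompact (S ∩ T) :=
  ⟨hS.1.inter hT, hS.2.inter_right hT'⟩

lemma add_singleton (hS : IsConvexCompact S) (v : V) : IsConvexCompact (S + {v}) :=
  ⟨hS.1.add (convex_singleton v), hS.2.add isCompact_singleton⟩

lemma smul (hS : IsConvexCompact S) (t : ℝ) : IsConvexCompact (t • S) :=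
  ⟨hS.1.smul t, hS.2.smul t⟩

end IsConvexCompact

section Coordinates

variable {k : ℕ}

lemma convex_coord_le (i : Fin k) (t : ℝ) : Convex ℝ {x : Eucl k | x i ≤ t} :=
  convex_halfSpace_le (f := fun x : Eucl k => x i) ⟨fun _ _ => rfl, fun _ _ => rfl⟩ t

lemma convex_coord_ge (i : Fin k) (t : ℝ) : Convex ℝ {x : Eucl k | t ≤ x i} :=
  convex_halfSpace_ge (f := fun x : Eucl k => x i) ⟨fun _ _ => rfl, fun _ _ => rfl⟩ t

lemma convex_coord_eq (i : Fin k) (t : ℝ) : Convex ℝ {x : Eucl k | x i = t} :=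
  convex_hyperplane (f := fun x : Eucl k => x i) ⟨fun _ _ => rfl, fun _ _ => rfl⟩ t

lemma isClosed_coord_le (i : Fin k) (t : ℝ) : IsClosed {x : Eucl k | x i ≤ t} :=
  isClosed_le (by fun_prop) (by fun_prop)

lemma isClosed_coord_ge (i : Fin k) (t : ℝ) : IsClosed {x : Eucl k | t ≤ x i} :=
  isClosed_le (by fun_prop) (by fun_prop)

lemma isClosed_coord_eq (i : Fin k) (t : ℝ) : IsClosed {x : Eucl k | x i = t} :=
  isClosed_eq (by fun_prop) (by fun_prop)

lemma inter_coord_le_union_ge (S : Set (Eucl k)) (i : Fin k) (t : ℝ) :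
    (S ∩ {x | x i ≤ t}) ∪ (S ∩ {x | t ≤ x i}) = S := by
  rw [← Set.inter_union_distrib_left]
  exact Set.inter_eq_left.2 fun x _ => le_total (x i) t

lemma inter_coord_eq (S : Set (Eucl k)) (i : Fin k) (t : ℝ) :
    S ∩ {x | x i = t} = (S ∩ {x | x i ≤ t}) ∩ (S ∩ {x | t ≤ x i}) := by
  ext x
  have : x i = t ↔ x i ≤ t ∧ t ≤ x i := le_antisymm_iff
  simp only [Set.mem_inter_iff, Set.mem_ofPred_eq, this]
  tauto

namespace IsConvexCompact

variable {S : Set (Eucl k)}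

lemma inter_le (hS : IsConvexCompact S) (i : Fin k) (t : ℝ) :
    IsConvexCompact (S ∩ {x | x i ≤ t}) :=
  hS.inter_closed (convex_coord_le i t) (isClosed_coord_le i t)

lemma inter_ge (hS : IsConvexCompact S) (i : Fin k) (t : ℝ) :
    IsConvexCompact (S ∩ {x | t ≤ x i}) :=
  hS.inter_closed (convex_coord_ge i t) (isClosed_coord_ge i t)

lemma inter_eq (hS : IsConvexCompact S) (i : Fin k) (t : ℝ) :
    IsConvexCompact (S ∩ {x | x i = t}) :=
  hS.inter_closed (convex_coord_eq i t) (isClosed_coord_eq i t)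

lemma exists_coord_bound (hS : IsConvexCompact S) : ∃ R : ℕ, ∀ x ∈ S, ∀ i, |x i| ≤ R := by
  obtain ⟨C, hC⟩ := hS.2.isBounded.exists_norm_le
  obtain ⟨R, hR⟩ := exists_nat_ge C
  exact ⟨R, fun x hx i => ((PiLp.norm_apply_le x i).trans (hC x hx)).trans hR⟩

end IsConvexCompact

/-- The axis-parallel unit cube with lowest vertex `b`. -/
def unitBox (b : Fin k → ℝ) : Set (Eucl k) := {x | ∀ i, b i ≤ x i ∧ x i ≤ b i + 1}

lemma unitBox_eq_iInter (b : Fin k → ℝ) :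
    unitBox b = ⋂ i, ({x : Eucl k | b i ≤ x i} ∩ {x | x i ≤ b i + 1}) := by
  ext x; simp [unitBox]

lemma convex_unitBox (b : Fin k → ℝ) : Convex ℝ (unitBox b) := by
  rw [unitBox_eq_iInter]
  exact convex_iInter fun i => (convex_coord_ge i _).inter (convex_coord_le i _)

lemma isClosed_unitBox (b : Fin k → ℝ) : IsClosed (unitBox b) := by
  rw [unitBox_eq_iInter]
  exact isClosed_iInter fun i => (isClosed_coord_ge i _).inter (isClosed_coord_le i _)

lemma isConvexCompact_unitBox (b : Fin k → ℝ) : IsConvexCompact (unitBox b) := by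
  refine ⟨convex_unitBox b, Metric.isCompact_of_isClosed_isBounded (isClosed_unitBox b) ?_⟩
  have h : unitBox b ⊆ (PiLp.continuousLinearEquiv 2 ℝ (fun _ : Fin k => ℝ)).symm ''
      Set.Icc b (fun i => b i + 1) := by
    intro x hx
    exact ⟨x.ofLp, ⟨fun i => (hx i).1, fun i => (hx i).2⟩, rfl⟩
  exact (isCompact_Icc.image (ContinuousLinearEquiv.continuous _)).isBounded.subset h

lemma unitBox_add_singleton (b : Fin k → ℝ) (v : Eucl k) :
    unitBox b + {v} = unitBox (fun i => b i + v i) := by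
  ext x
  simp only [Set.add_singleton, Set.image_add_right, Set.mem_preimage, unitBox, Set.mem_ofPred_eq,
    PiLp.add_apply, PiLp.neg_apply]
  refine forall_congr' fun i => ⟨fun h => ⟨?_, ?_⟩, fun h => ⟨?_, ?_⟩⟩ <;> linarith [h.1, h.2]

end Coordinates

/-- A set functional on `ℝᵏ` behaving on compact convex sets like a translation invariant valuation,
homogeneous of degree `k` and bounded on the subsets of the unit cube. -/
structure IsTopValuation {k : ℕ} (φ : Set (Eucl k) → ℝ) : Prop where
  empty : φ ∅ = 0
  cut : ∀ S, IsConvexCompact S → ∀ (i : Fin k) (t : ℝ),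
    φ S + φ (S ∩ {x | x i = t}) = φ (S ∩ {x | x i ≤ t}) + φ (S ∩ {x | t ≤ x i})
  translate : ∀ S, IsConvexCompact S → ∀ v : Eucl k, φ (S + {v}) = φ S
  smul : ∀ S, IsConvexCompact S → ∀ t : ℝ, 0 < t → φ (t • S) = t ^ k * φ S
  bounded : ∃ M : ℝ, ∀ S, IsConvexCompact S → S ⊆ unitBox 0 → |φ S| ≤ M

namespace IsTopValuation

variable {k : ℕ} {φ : Set (Eucl k) → ℝ}

lemma abs_le_of_subset_unitBox (h : IsTopValuation φ) {M : ℝ}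
    (hM : ∀ S, IsConvexCompact S → S ⊆ unitBox 0 → |φ S| ≤ M)
    {S : Set (Eucl k)} (hS : IsConvexCompact S) {b : Fin k → ℝ} (hb : S ⊆ unitBox b) :
    |φ S| ≤ M := by
  rw [← h.translate S hS (WithLp.toLp 2 (-b))]
  refine hM _ (hS.add_singleton _) ((Set.add_subset_add_right hb).trans ?_)
  rw [unitBox_add_singleton]
  intro x hx
  simpa [unitBox] using hx

/-- Cutting into slabs of width one. -/
lemma abs_le_of_slabs (h : IsTopValuation φ) {B : ℝ} (i : Fin k) (N : ℕ) :
    ∀ S, IsConvexCompact S → (∀ x ∈ S, 0 ≤ x i ∧ x i ≤ (N : ℝ) + 1) →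
      (∀ T ⊆ S, IsConvexCompact T → ∀ c : ℝ, (∀ x ∈ T, c ≤ x i ∧ x i ≤ c + 1) → |φ T| ≤ B) →
      |φ S| ≤ (2 * N + 1) * B := by
  induction N with
  | zero =>
    intro S hS hx hB
    simpa using hB S subset_rfl hS 0 (by simpa using hx)
  | succ N ih =>
    intro S hS hx hB
    have h1 := ih _ (hS.inter_le i (N + 1)) (fun x hx' => ⟨(hx x hx'.1).1, hx'.2⟩)
      (fun T hT => hB T (hT.trans Set.inter_subset_left))
    have h2 := hB _ Set.inter_subset_left (hS.inter_ge i (N + 1)) (N + 1)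
      (fun x hx' => ⟨hx'.2, by have := (hx x hx'.1).2; push_cast at this; linarith⟩)
    have h3 := hB _ Set.inter_subset_left (hS.inter_eq i (N + 1)) (N + 1)
      (fun x hx' => ⟨(Set.mem_ofPred.1 hx'.2).ge, by
        have : x i = N + 1 := hx'.2
        linarith⟩)
    have h4 := h.cut S hS i (N + 1)
    rw [abs_le] at *
    push_cast
    constructor <;> linarith [h1.1, h1.2, h2.1, h2.2, h3.1, h3.2]

lemma abs_le_of_subset_box (h : IsTopValuation φ) {M : ℝ}
    (hM : ∀ S, IsConvexCompact S → S ⊆ unitBox 0 → |φ S| ≤ M) (N : ℕ) (J : Finset (Fin k)) :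
    ∀ S, IsConvexCompact S → ∀ b : Fin k → ℝ, (∀ x ∈ S, ∀ i ∈ J, 0 ≤ x i ∧ x i ≤ (N : ℝ) + 1) →
      (∀ x ∈ S, ∀ i ∉ J, b i ≤ x i ∧ x i ≤ b i + 1) → |φ S| ≤ (2 * N + 1) ^ J.card * M := by
  induction J using Finset.induction_on with
  | empty =>
    intro S hS b _ hb
    simpa using h.abs_le_of_subset_unitBox hM hS (fun x hx i => hb x hx i (by simp))
  | insert i J hi ih =>
    intro S hS b hJ hb
    rw [Finset.card_insert_of_notMem hi, pow_succ', mul_assoc]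
    refine h.abs_le_of_slabs i N S hS (fun x hx => hJ x hx i (by simp)) fun T hTS hT c hc => ?_
    refine ih T hT (Function.update b i c)
      (fun x hx j hj => hJ x (hTS hx) j (Finset.mem_insert_of_mem hj)) fun x hx j hj => ?_
    rcases eq_or_ne j i with rfl | hji
    · simpa using hc x hx
    · simpa [hji] using hb x (hTS hx) j (by simp [hji, hj])

/-- Homogeneity of top degree forces simplicity. -/
lemma eq_zero_of_subset_hyperplane (h : IsTopValuation φ) {S : Set (Eucl k)}
    (hS : IsConvexCompact S) (i : Fin k) (t : ℝ) (hi : ∀ x ∈ S, x i = t) : φ S = 0 := by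
  obtain ⟨M, hM⟩ := h.bounded
  obtain ⟨R, hR⟩ := hS.exists_coord_bound
  have hM0 : 0 ≤ M := (abs_nonneg _).trans
    (hM ∅ ⟨convex_empty, isCompact_empty⟩ (Set.empty_subset _))
  set v : Eucl k := WithLp.toLp 2 (Function.update (fun _ => (R : ℝ)) i (-t)) with hv
  have key : ∀ N : ℕ, 0 < N → N * |φ S| ≤ (4 * R + 1) ^ (k - 1) * M := by
    intro N hN
    have hN0 : (1 : ℝ) ≤ N := by exact_mod_cast hN
    have h1 := h.abs_le_of_subset_box hM (2 * R * N) (Finset.univ.erase i)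
      ((N : ℝ) • (S + {v})) ((hS.add_singleton v).smul _) 0 (by
        rintro _ ⟨_, ⟨x, hx, _, rfl, rfl⟩, rfl⟩ j hj
        have hj' : j ≠ i := Finset.ne_of_mem_erase hj
        have := abs_le.1 (hR x hx j)
        simp only [PiLp.smul_apply, PiLp.add_apply, hv, smul_eq_mul, Function.update_of_ne hj']
        push_cast
        constructor <;> nlinarith [this.1, this.2]) (by
        rintro _ ⟨_, ⟨x, hx, _, rfl, rfl⟩, rfl⟩ j hj
        obtain rfl : j = i := by simpa using hj
        simp [hv, hi x hx])
    rw [h.smul _ (hS.add_singleton v) _ (by linarith), h.translate _ hS, abs_mul,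
      abs_of_nonneg (by positivity), Finset.card_erase_of_mem (Finset.mem_univ i), Finset.card_univ,
      Fintype.card_fin] at h1
    have hk : (N : ℝ) ^ k = N ^ (k - 1) * N := by
      rw [← pow_succ, Nat.sub_add_cancel (Fin.pos i)]
    have h2 : (2 * ((2 * R * N : ℕ) : ℝ) + 1) ^ (k - 1) ≤ N ^ (k - 1) * (4 * R + 1) ^ (k - 1) := by
      rw [← mul_pow]
      gcongr
      push_cast
      nlinarith
    have h3 := h1.trans (mul_le_mul_of_nonneg_right h2 hM0)
    rw [hk, mul_assoc, mul_assoc] at h3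
    exact le_of_mul_le_mul_left h3 (by positivity)
  by_contra hne
  have hpos : 0 < |φ S| := abs_pos.2 hne
  obtain ⟨N, hN⟩ := exists_nat_gt ((4 * R + 1) ^ (k - 1) * M / |φ S|)
  have hN0 : 0 < N := by
    have : (0 : ℝ) < N := lt_of_le_of_lt (by positivity) hN
    exact_mod_cast this
  rw [div_lt_iff₀ hpos] at hN
  exact absurd (key N hN0) (not_le.2 hN)

lemma cut_simple (h : IsTopValuation φ) {S : Set (Eucl k)} (hS : IsConvexCompact S)
    (i : Fin k) (t : ℝ) : φ S = φ (S ∩ {x | x i ≤ t}) + φ (S ∩ {x | t ≤ x i}) := by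
  have := h.cut S hS i t
  rwa [h.eq_zero_of_subset_hyperplane (hS.inter_eq i t) i t (fun x hx => hx.2), add_zero] at this

/-- The slab of points whose `i`-th coordinate lies in `[c, c + 1]`. -/
def slab (i : Fin k) (c : ℝ) : Set (Eucl k) := {x | c ≤ x i ∧ x i ≤ c + 1}

@[simp] lemma mem_slab {i : Fin k} {c : ℝ} {x : Eucl k} :
    x ∈ slab i c ↔ c ≤ x i ∧ x i ≤ c + 1 := Iff.rfl

lemma _root_.IsConvexCompact.inter_slab {S : Set (Eucl k)} (hS : IsConvexCompact S) (i : Fin k)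
    (c : ℝ) : IsConvexCompact (S ∩ slab i c) :=
  hS.inter_closed ((convex_coord_ge i c).inter (convex_coord_le i _))
    ((isClosed_coord_ge i c).inter (isClosed_coord_le i _))

lemma eq_sum_slabs (h : IsTopValuation φ) {S : Set (Eucl k)} (hS : IsConvexCompact S)
    (i : Fin k) (hi : ∀ x ∈ S, 0 ≤ x i ∧ x i ≤ 3) : φ S = ∑ j : Fin 3, φ (S ∩ slab i (j : ℕ)) := by
  have h0 : S ∩ {x | x i ≤ 1} = S ∩ slab i ((0 : Fin 3) : ℕ) := by
    ext x
    refine and_congr_right fun hx => ?_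
    have := hi x hx
    simp [this.1]
  have h1 : S ∩ {x | 1 ≤ x i} ∩ {x | x i ≤ 2} = S ∩ slab i ((1 : Fin 3) : ℕ) := by
    ext x
    norm_num [and_assoc]
  have h2 : S ∩ {x | 1 ≤ x i} ∩ {x | 2 ≤ x i} = S ∩ slab i ((2 : Fin 3) : ℕ) := by
    rw [Set.inter_assoc]
    ext x
    refine and_congr_right fun hx => ?_
    have := hi x hx
    norm_num
    constructor
    · rintro ⟨_, h2⟩
      exact ⟨h2, by linarith⟩
    · rintro ⟨h2, _⟩
      exact ⟨by linarith, h2⟩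
  rw [Fin.sum_univ_three, h.cut_simple hS i 1, h.cut_simple (hS.inter_ge i 1) i 2, ← add_assoc,
    h0, h1, h2]

lemma abs_le_of_subset_triple_box (h : IsTopValuation φ) {M : ℝ}
    (hM : ∀ S, IsConvexCompact S → S ⊆ unitBox 0 → |φ S| ≤ M) (J : Finset (Fin k)) :
    ∀ S, IsConvexCompact S → ∀ b : Fin k → ℝ, (∀ x ∈ S, ∀ i ∈ J, 0 ≤ x i ∧ x i ≤ 3) →
      (∀ x ∈ S, ∀ i ∉ J, b i ≤ x i ∧ x i ≤ b i + 1) → |φ S| ≤ 3 ^ J.card * M := by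
  induction J using Finset.induction_on with
  | empty =>
    intro S hS b _ hb
    simpa using h.abs_le_of_subset_unitBox hM hS (fun x hx i => hb x hx i (by simp))
  | insert i J hi ih =>
    intro S hS b hJ hb
    rw [Finset.card_insert_of_notMem hi, pow_succ', mul_assoc,
      h.eq_sum_slabs hS i (fun x hx => hJ x hx i (by simp))]
    refine (Finset.abs_sum_le_sum_abs _ _).trans
      ((Finset.sum_le_card_nsmul _ _ (3 ^ J.card * M) fun c _ => ?_).trans_eq (by simp))
    refine ih _ (hS.inter_slab i _) (Function.update b i (c : ℕ))
      (fun x hx j hj => hJ x hx.1 j (Finset.mem_insert_of_mem hj)) fun x hx j hj => ?_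
    rcases eq_or_ne j i with rfl | hji
    · simpa using hx.2
    · simpa [hji] using hb x hx.1 j (by simp [hji, hj])

/-- If one of the cells of the `3 × ⋯ × 3` grid does not contribute, the bound improves. -/
lemma abs_le_of_cell_eq_zero (h : IsTopValuation φ) {M : ℝ}
    (hM : ∀ S, IsConvexCompact S → S ⊆ unitBox 0 → |φ S| ≤ M) (a : Fin k → Fin 3)
    (J : Finset (Fin k)) :
    ∀ S, IsConvexCompact S → ∀ b : Fin k → ℝ, (∀ x ∈ S, ∀ i ∈ J, 0 ≤ x i ∧ x i ≤ 3) →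
      (∀ x ∈ S, ∀ i ∉ J, b i ≤ x i ∧ x i ≤ b i + 1) →
      φ (S ∩ {x | ∀ i ∈ J, x ∈ slab i (a i : ℕ)}) = 0 → |φ S| ≤ (3 ^ J.card - 1) * M := by
  induction J using Finset.induction_on with
  | empty =>
    intro S hS b _ hb h0
    have : φ S = 0 := by simpa using h0
    simp [this]
  | insert i J hi ih =>
    intro S hS b hJ hb h0
    rw [Finset.card_insert_of_notMem hi,
      h.eq_sum_slabs hS i (fun x hx => hJ x hx i (by simp))]
    refine (Finset.abs_sum_le_sum_abs _ _).trans ?_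
    have hJ' : ∀ c : Fin 3, ∀ x ∈ S ∩ slab i (c : ℕ), ∀ j ∈ J, 0 ≤ x j ∧ x j ≤ 3 :=
      fun c x hx j hj => hJ x hx.1 j (Finset.mem_insert_of_mem hj)
    have hb' : ∀ c : Fin 3, ∀ x ∈ S ∩ slab i (c : ℕ), ∀ j ∉ J,
        Function.update b i (c : ℕ) j ≤ x j ∧ x j ≤ Function.update b i (c : ℕ) j + 1 := by
      intro c x hx j hj
      rcases eq_or_ne j i with rfl | hji
      · simpa using hx.2
      · simpa [hji] using hb x hx.1 j (by simp [hji, hj])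
    have hgood := ih _ (hS.inter_slab i (a i : ℕ)) _ (hJ' (a i)) (hb' (a i)) (by
      rw [← h0, Set.inter_assoc]
      congr 2
      ext x
      simp)
    rw [← Finset.add_sum_erase _ _ (Finset.mem_univ (a i)), pow_succ]
    have hrest := Finset.sum_le_card_nsmul (Finset.univ.erase (a i))
      (fun c : Fin 3 => |φ (S ∩ slab i (c : ℕ))|) (3 ^ J.card * M)
      (fun c _ => h.abs_le_of_subset_triple_box hM J _ (hS.inter_slab i _) _ (hJ' c) (hb' c))
    rw [Finset.card_erase_of_mem (Finset.mem_univ _)] at hrest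
    simp only [Finset.card_univ, Fintype.card_fin, nsmul_eq_mul, Nat.add_one_sub_one,
      Nat.cast_ofNat] at hrest
    linarith

/-- A closed convex set meeting every corner cell of the `3 × ⋯ × 3` grid contains the
central cell. -/
lemma _root_.unitBox_one_subset {S : Set (Eucl k)} (hS : IsConvexCompact S)
    (hmeet : ∀ a : Fin k → Fin 3, (S ∩ unitBox (fun i => ((a i : ℕ) : ℝ))).Nonempty) :
    unitBox (fun _ => 1) ⊆ S := by
  intro x hx
  by_contra hxS
  obtain ⟨f, u, hfx, hfS⟩ := geometric_hahn_banach_point_closed hS.1 hS.2.isClosed hxS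
  have hf : ∀ y : Eucl k, f y = ∑ i, y i * f (EuclideanSpace.single i 1) := by
    intro y
    conv_lhs => rw [← (EuclideanSpace.basisFun (Fin k) ℝ).sum_repr y]
    simp
  obtain ⟨p, hpS, hp⟩ := hmeet fun i => if f (EuclideanSpace.single i 1) ≤ 0 then 2 else 0
  have hle : f p ≤ f x := by
    rw [hf p, hf x]
    refine Finset.sum_le_sum fun i _ => ?_
    have h1 := hp i
    have h2 := hx i
    beta_reduce at h1 h2
    split_ifs at h1 with hi
    · norm_num at h1 h2
      nlinarith [h1.1, h2.2]
    · norm_num at h1 h2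
      nlinarith [h1.2, h2.1]
  linarith [hfS p hpS]

lemma abs_le_contract (h : IsTopValuation φ) (h0 : φ (unitBox 0) = 0) {M : ℝ}
    (hM : ∀ S, IsConvexCompact S → S ⊆ unitBox 0 → |φ S| ≤ M)
    {S : Set (Eucl k)} (hS : IsConvexCompact S) (hSQ : S ⊆ unitBox 0) :
    |φ S| ≤ (3 ^ k - 1) / 3 ^ k * M := by
  have hT := hS.smul 3
  obtain ⟨a, ha⟩ : ∃ a : Fin k → Fin 3,
      φ (((3 : ℝ) • S) ∩ unitBox (fun i => ((a i : ℕ) : ℝ))) = 0 := by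
    by_cases hmeet : ∀ a : Fin k → Fin 3,
        (((3 : ℝ) • S) ∩ unitBox (fun i => ((a i : ℕ) : ℝ))).Nonempty
    · refine ⟨fun _ => 1, ?_⟩
      have hsub := unitBox_one_subset hT hmeet
      have : unitBox (fun _ : Fin k => (((1 : Fin 3) : ℕ) : ℝ)) =
          unitBox 0 + {WithLp.toLp 2 (fun _ => (1 : ℝ))} := by
        rw [unitBox_add_singleton]; simp
      rw [Set.inter_eq_self_of_subset_right (by simpa using hsub), this,
        h.translate _ (isConvexCompact_unitBox 0), h0]
    · push Not at hmeet
      obtain ⟨a, ha⟩ := hmeet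
      exact ⟨a, by rw [ha, h.empty]⟩
  have h1 := h.abs_le_of_cell_eq_zero hM a Finset.univ _ hT 0 (by
    rintro _ ⟨x, hx, rfl⟩ i _
    have := hSQ hx i
    simp only [Pi.zero_apply] at this
    simp only [PiLp.smul_apply, smul_eq_mul]
    constructor <;> linarith [this.1, this.2]) (by simp) (by
    rw [← ha]
    congr 2
    ext x
    simp [unitBox, slab])
  rw [h.smul S hS 3 (by norm_num), abs_mul, abs_of_nonneg (by positivity), Finset.card_univ,
    Fintype.card_fin] at h1
  rw [div_mul_eq_mul_div, le_div_iff₀ (by positivity)]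
  linarith

/-- A top-degree valuation vanishing on the unit cube vanishes identically. -/
theorem eq_zero (h : IsTopValuation φ) (h0 : φ (unitBox 0) = 0) {S : Set (Eucl k)}
    (hS : IsConvexCompact S) : φ S = 0 := by
  have hcube : ∀ S, IsConvexCompact S → S ⊆ unitBox 0 → φ S = 0 := by
    intro S hS hSQ
    obtain ⟨M, hM⟩ := h.bounded
    have hpow : ∀ m : ℕ, ∀ S, IsConvexCompact S → S ⊆ unitBox 0 →
        |φ S| ≤ ((3 ^ k - 1) / 3 ^ k) ^ m * M := by
      intro m
      induction m with
      | zero => simpa using hM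
      | succ m ih =>
        intro S hS hSQ
        rw [pow_succ', mul_assoc]
        exact h.abs_le_contract h0 ih hS hSQ
    have h3 : (1 : ℝ) ≤ 3 ^ k := one_le_pow₀ (by norm_num)
    have hlim : Filter.Tendsto (fun m : ℕ => (((3 : ℝ) ^ k - 1) / 3 ^ k) ^ m * M)
        Filter.atTop (nhds (0 * M)) := by
      refine (tendsto_pow_atTop_nhds_zero_of_lt_one (div_nonneg (by linarith) (by positivity))
        ?_).mul_const M
      rw [div_lt_one (by positivity)]
      linarith
    have := ge_of_tendsto' hlim fun m => hpow m S hS hSQ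
    rw [zero_mul] at this
    exact abs_eq_zero.1 (le_antisymm this (abs_nonneg _))
  obtain ⟨R, hR⟩ := hS.exists_coord_bound
  have hR0 : (0 : ℝ) ≤ R := R.cast_nonneg
  have hpos : (0 : ℝ) < (2 * (R : ℝ) + 1)⁻¹ := by positivity
  have hT := hS.add_singleton (WithLp.toLp 2 fun _ => (R : ℝ))
  have h1 := hcube _ (hT.smul (2 * (R : ℝ) + 1)⁻¹) (by
    rintro _ ⟨_, ⟨x, hx, _, rfl, rfl⟩, rfl⟩ i
    have := abs_le.1 (hR x hx i)
    simp only [PiLp.smul_apply, PiLp.add_apply, smul_eq_mul, Pi.zero_apply, zero_add]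
    refine ⟨mul_nonneg hpos.le (by linarith [this.1]), ?_⟩
    rw [inv_mul_le_iff₀ (by positivity)]
    linarith [this.2])
  rw [h.smul _ hT _ hpos, h.translate _ hS] at h1
  exact (mul_eq_zero.1 h1).resolve_left (by positivity)

end IsTopValuation

namespace IsTopValuation

variable {k : ℕ}

lemma sub_const_mul {φ ψ : Set (Eucl k) → ℝ} (hφ : IsTopValuation φ) (hψ : IsTopValuation ψ)
    (c : ℝ) : IsTopValuation fun S => φ S - c * ψ S where
  empty := by simp [hφ.empty, hψ.empty]
  cut S hS i t := by linear_combination hφ.cut S hS i t - c * hψ.cut S hS i t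
  translate S hS v := by rw [hφ.translate S hS, hψ.translate S hS]
  smul S hS t ht := by
    rw [hφ.smul S hS t ht, hψ.smul S hS t ht]
    ring
  bounded := by
    obtain ⟨M, hM⟩ := hφ.bounded
    obtain ⟨M', hM'⟩ := hψ.bounded
    refine ⟨M + |c| * M', fun S hS hSQ => (abs_sub _ _).trans ?_⟩
    rw [abs_mul]
    exact add_le_add (hM S hS hSQ) (mul_le_mul_of_nonneg_left (hM' S hS hSQ) (abs_nonneg c))

lemma measureReal (ν : Measure (Eucl k)) [ν.IsAddHaarMeasure] :
    IsTopValuation fun S => ν.real S where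
  empty := by simp
  cut S hS i t := by
    rw [inter_coord_eq S i t]
    nth_rewrite 1 [← inter_coord_le_union_ge S i t]
    exact measureReal_union_add_inter (hS.inter_ge i t).2.measurableSet
      (hS.inter_le i t).2.measure_lt_top.ne (hS.inter_ge i t).2.measure_lt_top.ne
  translate S _ v := by simp [Measure.real]
  smul S _ t ht := by
    rw [Measure.real, Measure.addHaar_smul, ENNReal.toReal_mul, finrank_euclideanSpace_fin,
      ENNReal.toReal_ofReal (abs_nonneg _), abs_of_pos (pow_pos ht k), Measure.real]
  bounded := ⟨ν.real (unitBox 0), fun S _ hSQ => by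
    rw [abs_of_nonneg measureReal_nonneg]
    exact measureReal_mono hSQ (isConvexCompact_unitBox 0).2.measure_lt_top.ne⟩

end IsTopValuation

section Extension

variable {V : Type*} [NormedAddCommGroup V] [NormedSpace ℝ V]

open Classical in
/-- Extension by zero of a functional on convex bodies to all sets. -/
def ConvexBody.extend (μ : ConvexBody V → ℝ) (S : Set V) : ℝ :=
  if h : IsConvexCompact S ∧ S.Nonempty then μ ⟨S, h.1.1, h.1.2, h.2⟩ else 0

namespace ConvexBody

variable {μ : ConvexBody V → ℝ}

lemma extend_of_nonempty {S : Set V} (hS : IsConvexCompact S) (hne : S.Nonempty) :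
    extend μ S = μ ⟨S, hS.1, hS.2, hne⟩ :=
  dif_pos ⟨hS, hne⟩

lemma extend_coe (K : ConvexBody V) : extend μ (K : Set V) = μ K :=
  extend_of_nonempty ⟨K.convex, K.isCompact⟩ K.nonempty

@[simp] lemma extend_empty : extend μ ∅ = 0 :=
  dif_neg fun h => Set.not_nonempty_empty h.2

lemma extend_union_add_inter (hval : IsValuation μ) {A B : Set V} (hA : IsConvexCompact A)
    (hB : IsConvexCompact B) (hAB : Convex ℝ (A ∪ B)) :
    extend μ (A ∪ B) + extend μ (A ∩ B) = extend μ A + extend μ B := by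
  rcases A.eq_empty_or_nonempty with rfl | hAne
  · simp [add_comm]
  rcases B.eq_empty_or_nonempty with rfl | hBne
  · simp
  have hne : (A ∩ B).Nonempty := by
    have := isPreconnected_closed_iff.1 hAB.isPreconnected A B hA.2.isClosed hB.2.isClosed
      subset_rfl (hAne.mono fun x hx => ⟨Or.inl hx, hx⟩) (hBne.mono fun x hx => ⟨Or.inr hx, hx⟩)
    exact this.mono Set.inter_subset_right
  rw [extend_of_nonempty hA hAne, extend_of_nonempty hB hBne,
    extend_of_nonempty ⟨hAB, hA.2.union hB.2⟩ hAne.inl,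
    extend_of_nonempty ⟨hA.1.inter hB.1, hA.2.inter hB.2⟩ hne]
  exact hval _ _ _ _ rfl rfl

lemma extend_add_singleton (htrans : TransInv μ) {S : Set V} (hS : IsConvexCompact S) (v : V) :
    extend μ (S + {v}) = extend μ S := by
  rcases S.eq_empty_or_nonempty with rfl | hne
  · simp
  rw [extend_of_nonempty hS hne,
    extend_of_nonempty (hS.add_singleton v) (hne.add (Set.singleton_nonempty v))]
  exact htrans ⟨S, hS.1, hS.2, hne⟩ v

lemma extend_smul {k : ℕ} (hhom : Homog k μ) {S : Set V} (hS : IsConvexCompact S) {t : ℝ}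
    (ht : 0 < t) : extend μ (t • S) = t ^ k * extend μ S := by
  rcases S.eq_empty_or_nonempty with rfl | hne
  · simp
  rw [extend_of_nonempty hS hne, extend_of_nonempty (hS.smul t) hne.smul_set]
  exact hhom ⟨S, hS.1, hS.2, hne⟩ t ht

lemma isClosed_convex_nonemptyCompacts :
    IsClosed {K : TopologicalSpace.NonemptyCompacts V | Convex ℝ (K : Set V)} := by
  refine isClosed_of_closure_subset fun K hK x hx y hy a b ha hb hab => ?_
  rw [← K.isCompact.isClosed.closure_eq, Metric.mem_closure_iff]
  intro ε hε
  obtain ⟨L, hL, hKL⟩ := Metric.mem_closure_iff.1 hK (ε / 2) (half_pos hε)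
  have hfin : Metric.hausdorffEDist (K : Set V) L ≠ ⊤ :=
    Metric.hausdorffEDist_ne_top_of_nonempty_of_bounded K.nonempty L.nonempty
      K.isCompact.isBounded L.isCompact.isBounded
  rw [Metric.NonemptyCompacts.dist_eq] at hKL
  obtain ⟨x', hx', hxx'⟩ := Metric.exists_dist_lt_of_hausdorffDist_lt hx hKL hfin
  obtain ⟨y', hy', hyy'⟩ := Metric.exists_dist_lt_of_hausdorffDist_lt hy hKL hfin
  obtain ⟨p, hp, hpz⟩ := Metric.exists_dist_lt_of_hausdorffDist_lt'
    (hL hx' hy' ha hb hab) hKL hfin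
  refine ⟨p, hp, ?_⟩
  have h1 : dist (a • x + b • y) (a • x' + b • y') ≤ ε / 2 := by
    calc dist (a • x + b • y) (a • x' + b • y')
        ≤ dist (a • x) (a • x') + dist (b • y) (b • y') := dist_add_add_le _ _ _ _
      _ = a * dist x x' + b * dist y y' := by
        rw [dist_smul₀, dist_smul₀, Real.norm_of_nonneg ha, Real.norm_of_nonneg hb]
      _ ≤ a * (ε / 2) + b * (ε / 2) := by gcongr
      _ = ε / 2 := by rw [← add_mul, hab, one_mul]
  calc dist (a • x + b • y) p
      ≤ dist (a • x + b • y) (a • x' + b • y') + dist (a • x' + b • y') p := dist_triangle _ _ _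
    _ < ε / 2 + ε / 2 := by
      rw [dist_comm _ p]
      exact add_lt_add_of_le_of_lt h1 hpz
    _ = ε := add_halves ε

/-- Blaschke selection: the convex bodies inside a compact set form a compact family. -/
lemma isCompact_setOf_subset {Q : Set V} (hQ : IsCompact Q) :
    IsCompact {K : ConvexBody V | (K : Set V) ⊆ Q} := by
  set X : Set (TopologicalSpace.NonemptyCompacts V) :=
    {K | (K : Set V) ⊆ Q} ∩ {K | Convex ℝ (K : Set V)}
  have hX : IsCompact X :=
    (TopologicalSpace.NonemptyCompacts.isCompact_subsets_of_isCompact hQ).inter_right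
      isClosed_convex_nonemptyCompacts
  have := isCompact_iff_compactSpace.1 hX
  let g : X → ConvexBody V := fun K => ⟨K.1, K.2.2, K.1.isCompact, K.1.nonempty⟩
  have hg : Isometry g := Isometry.of_dist_eq fun _ _ => rfl
  convert isCompact_range hg.continuous
  ext K
  refine ⟨fun hK => ⟨⟨⟨⟨K, K.isCompact⟩, K.nonempty⟩, hK, K.convex⟩, rfl⟩, ?_⟩
  rintro ⟨L, rfl⟩
  exact L.2.1

lemma exists_abs_extend_le (hcont : Continuous μ) {Q : Set V} (hQ : IsCompact Q) :
    ∃ M : ℝ, ∀ S, IsConvexCompact S → S ⊆ Q → |extend μ S| ≤ M := by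
  obtain ⟨M, hM⟩ := (isCompact_setOf_subset hQ).exists_bound_of_continuousOn hcont.continuousOn
  refine ⟨max M 0, fun S hS hSQ => ?_⟩
  rcases S.eq_empty_or_nonempty with rfl | hne
  · simp
  rw [extend_of_nonempty hS hne]
  exact (hM ⟨S, hS.1, hS.2, hne⟩ hSQ).trans (le_max_left _ _)

end ConvexBody

lemma IsConvexCompact.image {W : Type*} [NormedAddCommGroup W] [NormedSpace ℝ W] {S : Set W}
    (hS : IsConvexCompact S) (f : W →L[ℝ] V) : IsConvexCompact (f '' S) :=
  ⟨hS.1.linear_image f.toLinearMap, hS.2.image f.continuous⟩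

/-- Pulling back along an injective linear map from `ℝᵏ`. -/
lemma IsTopValuation.of_extend {k : ℕ} {μ : ConvexBody V → ℝ} (hval : IsValuation μ)
    (hcont : Continuous μ) (htrans : TransInv μ) (hhom : Homog k μ) (f : Eucl k →L[ℝ] V)
    (hf : Function.Injective f) : IsTopValuation fun S => ConvexBody.extend μ (f '' S) where
  empty := by simp
  cut S hS i t := by
    have h3 : f '' S = f '' (S ∩ {x | x i ≤ t}) ∪ f '' (S ∩ {x | t ≤ x i}) := by
      rw [← Set.image_union, inter_coord_le_union_ge]
    rw [inter_coord_eq S i t, Set.image_inter hf, h3]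
    refine ConvexBody.extend_union_add_inter hval ((hS.inter_le i t).image f)
      ((hS.inter_ge i t).image f) ?_
    rw [← h3]
    exact (hS.image f).1
  translate S hS v := by
    rw [Set.image_add, Set.image_singleton]
    exact ConvexBody.extend_add_singleton htrans (hS.image f) _
  smul S hS t ht := by
    rw [image_smul_set]
    exact ConvexBody.extend_smul hhom (hS.image f) ht
  bounded := by
    obtain ⟨M, hM⟩ := ConvexBody.exists_abs_extend_le hcont ((isConvexCompact_unitBox 0).image f).2
    exact ⟨M, fun S hS hSQ => hM _ (hS.image f) (Set.image_mono hSQ)⟩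

end Extension

lemma unitBox_measureReal_pos {k : ℕ} (ν : Measure (Eucl k)) [ν.IsAddHaarMeasure] :
    0 < ν.real (unitBox 0) := by
  refine ENNReal.toReal_pos ?_ (isConvexCompact_unitBox 0).2.measure_lt_top.ne
  have hopen : IsOpen {x : Eucl k | ∀ i, 0 < x i ∧ x i < 1} := by
    simp only [Set.ofPred_forall]
    exact isOpen_iInter_of_finite fun i =>
      isOpen_Ioo.preimage (f := fun x : Eucl k => x i) (by fun_prop)
  have hne : {x : Eucl k | ∀ i, 0 < x i ∧ x i < 1}.Nonempty :=
    ⟨WithLp.toLp 2 fun _ => 1 / 2, fun i => by norm_num⟩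
  refine (measure_pos_of_superset (fun x hx i => ?_) (hopen.measure_pos ν hne).ne').ne'
  simpa using ⟨(hx i).1.le, (hx i).2.le⟩

/-- Existence of the Klain function: a continuous translation invariant valuation on `ℝⁿ`
which is homogeneous of degree `k` restricts, on each `k`-dimensional subspace `E`, to a
multiple of the `k`-dimensional Hausdorff (i.e. Lebesgue) measure. -/
theorem klain_function_exists (n k : ℕ) (hn : 1 ≤ n) (hk : k ≤ n)
    (μ : ConvexBody (Eucl n) → ℝ)
    (hval : IsValuation μ) (hcont : Continuous μ) (htrans : TransInv μ) (hhom : Homog k μ)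
    (E : Submodule ℝ (Eucl n)) (hE : Module.finrank ℝ E = k) :
    ∃ c : ℝ, ∀ K : ConvexBody (Eucl n), (K : Set (Eucl n)) ⊆ (E : Set (Eucl n)) →
      μ K = c * (μH[(k : ℝ)] (K : Set (Eucl n))).toReal := by
  subst hE
  set k := Module.finrank ℝ E
  have hfr : Module.finrank ℝ (Eucl k) = k := by simp
  have : (μH[(k : ℝ)] : Measure (Eucl k)).IsAddHaarMeasure := by
    have := isAddHaarMeasure_hausdorffMeasure (E := Eucl k)
    rwa [hfr] at this
  let f : Eucl k →ₗᵢ[ℝ] Eucl n :=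
    E.subtypeₗᵢ.comp (stdOrthonormalBasis ℝ E).repr.symm.toLinearIsometry
  have hψ := IsTopValuation.of_extend hval hcont htrans hhom f.toContinuousLinearMap f.injective
  have hν := IsTopValuation.measureReal (μH[(k : ℝ)] : Measure (Eucl k))
  have hpos := unitBox_measureReal_pos (μH[(k : ℝ)] : Measure (Eucl k))
  set c := ConvexBody.extend μ (f.toContinuousLinearMap '' unitBox 0) /
    (μH[(k : ℝ)] : Measure (Eucl k)).real (unitBox 0) with hc
  refine ⟨c, fun K hK => ?_⟩
  have himage : f '' (f ⁻¹' (K : Set (Eucl n))) = K := by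
    refine Set.image_preimage_eq_of_subset fun x hx => ?_
    exact ⟨(stdOrthonormalBasis ℝ E).repr ⟨x, hK hx⟩, by simp [f]⟩
  have hpre : IsConvexCompact (f ⁻¹' (K : Set (Eucl n))) :=
    ⟨K.convex.linear_preimage f.toLinearMap,
      f.isometry.isClosedEmbedding.isCompact_preimage K.isCompact⟩
  have h0 := (hψ.sub_const_mul hν c).eq_zero (by rw [hc, div_mul_cancel₀ _ hpos.ne', sub_self]) hpre
  have hmeas : μH[(k : ℝ)] (K : Set (Eucl n)) = μH[(k : ℝ)] (f ⁻¹' (K : Set (Eucl n))) := by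
    conv_lhs => rw [← himage]
    exact f.isometry.hausdorffMeasure_image (Or.inl k.cast_nonneg) _
  rw [LinearIsometry.coe_toContinuousLinearMap, himage, ConvexBody.extend_coe] at h0
  rw [hmeas]
  exact sub_eq_zero.1 h0
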